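/- Assume P₁(Z₁=0)>0 (i.e. P(Q(0)>0)>0) and that 𝓘 is nonempty. Then for all i,j ∈ Cl(𝓘), lim_{n→∞}(1/n)·log P_i(Zₙ=j) = lim_{n→∞}(1/n)·log E[Qₙ(z₀)·f_{0,n}(0)^{z₀−1}·∏_{i=1}^{n−1} f_i′(f_{i,n}(0))], where both limits exist and coincide. -/

import Mathlib

open MeasureTheory ProbabilityTheory Filter Topology

noncomputable section

/-- `q` is a probability mass function on `ℕ`. -/
def IsPMF (q : ℕ → ℝ) : Prop := (∀ k, 0 ≤ q k) ∧ (∑' k, q k) = 1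

/-- Mean `m_q` of a mass function on `ℕ`. -/
def pmfMean (q : ℕ → ℝ) : ℝ := ∑' k : ℕ, (k : ℝ) * q k

/-- `X = log m_Q`. -/
def envX (q : ℕ → ℝ) : ℝ := Real.log (pmfMean q)

/-- Probability generating function of `q`. -/
def pgf (q : ℕ → ℝ) (s : ℝ) : ℝ := ∑' k, q k * s ^ k

/-- Derivative `f'` of the probability generating function of `q`. -/
def dpgf (q : ℕ → ℝ) (s : ℝ) : ℝ := ∑' k : ℕ, (k : ℝ) * q k * s ^ (k - 1)

/-- Second factorial moment `f''(1)` of `q`. -/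
def pgf2 (q : ℕ → ℝ) : ℝ := ∑' k : ℕ, (k : ℝ) * ((k : ℝ) - 1) * q k

/-- Convolution of two mass functions on `ℕ`. -/
def conv (q r : ℕ → ℝ) (k : ℕ) : ℝ := ∑ j ∈ Finset.range (k + 1), q j * r (k - j)

/-- `z`-fold convolution power `q^{*z}`. -/
def convPow (q : ℕ → ℝ) : ℕ → ℕ → ℝ
  | 0 => fun k => if k = 0 then 1 else 0
  | z + 1 => conv q (convPow q z)

/-- Quenched `n`-step transition probabilities of the branching process in the (varying)
environment `e`, where `e i` is the offspring distribution of generation `i + 1`: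
`qtrans e n k j = P(Z_n = j | Z_0 = k, environment e)`. -/
def qtrans (e : ℕ → ℕ → ℝ) : ℕ → ℕ → ℕ → ℝ
  | 0, k, j => if j = k then 1 else 0
  | n + 1, k, j => ∑' i : ℕ, qtrans e n k i * convPow (e n) i j

/-- Composition `f_{i,n} = f_{i+1} ∘ ⋯ ∘ f_n` of generating functions, where `e m` is the
offspring distribution `Q_{m+1}`. -/
def Fcomp (e : ℕ → ℕ → ℝ) (i n : ℕ) (s : ℝ) : ℝ :=
  (List.range (n - i)).foldr (fun m t => pgf (e (i + m)) t) s

/-- Extension of a finite environment to an infinite one (by a trivial environment). -/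
def extEnv (n : ℕ) (e : Fin n → ℕ → ℝ) : ℕ → ℕ → ℝ := fun i =>
  if h : i < n then e ⟨i, h⟩ else fun k => if k = 1 then 1 else 0

/-- Law of the first `n` generations of an i.i.d. environment with marginal `ν`. -/
def envPi (ν : Measure (ℕ → ℝ)) [SigmaFinite ν] (n : ℕ) :
    Measure (Fin n → ℕ → ℝ) :=
  Measure.pi fun _ : Fin n => ν

/-- Annealed probability `P_k(Z_n = j)` of the BPRE whose environment is i.i.d. with
marginal law `ν`. -/
def aP (ν : Measure (ℕ → ℝ)) [SigmaFinite ν] (n k j : ℕ) : ℝ :=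
  ∫ e, qtrans (extEnv n e) n k j ∂(envPi ν n)

/-- The set `𝓘 = {j ≥ 1 : P(Q(j) > 0, Q(0) > 0) > 0}`. -/
def Iset (ν : Measure (ℕ → ℝ)) : Set ℕ :=
  {j | 1 ≤ j ∧ 0 < ν {q | 0 < q j ∧ 0 < q 0}}

/-- The set `Cl(𝓘)` of states reachable from `𝓘`. -/
def clI (ν : Measure (ℕ → ℝ)) [SigmaFinite ν] : Set ℕ :=
  {k | 1 ≤ k ∧ ∃ n, ∃ j ∈ Iset ν, 0 < aP ν n j k}

/-- The set `Cl({z})` of states reachable from `z`. -/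
def clz (ν : Measure (ℕ → ℝ)) [SigmaFinite ν] (z : ℕ) : Set ℕ :=
  {k | 1 ≤ k ∧ ∃ n, 0 < aP ν n z k}

/-- The spine (Geiger) expectation
`E[Q_n(z₀) f_{0,n}(0)^{z₀-1} ∏_{i=1}^{n-1} f_i'(f_{i,n}(0))]`. -/
def geigerExp (ν : Measure (ℕ → ℝ)) [SigmaFinite ν] (z₀ n : ℕ) : ℝ :=
  ∫ e, (extEnv n e (n - 1)) z₀ * (Fcomp (extEnv n e) 0 n 0) ^ (z₀ - 1) *
      ∏ i ∈ Finset.Icc 1 (n - 1), dpgf (extEnv n e (i - 1)) (Fcomp (extEnv n e) i n 0)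
    ∂(envPi ν n)

/-- `Λ(0) = - log inf_{λ ≥ 0} E[e^{-λ X}]`, the rate function of `S` at `0`. -/
def Lam0 (ν : Measure (ℕ → ℝ)) : ℝ :=
  - Real.log (sInf ((fun l : ℝ => ∫ q, Real.exp (-(l * envX q)) ∂ν) '' {l : ℝ | 0 ≤ l}))

/-- Truncated standardized second moment `ξ_q(a)`. -/
def xi (q : ℕ → ℝ) (a : ℕ) : ℝ :=
  (∑' y : ℕ, if a ≤ y then (y : ℝ) ^ 2 * q y else 0) / (pmfMean q) ^ 2

/-- Assumption A2 : the random walk is non-lattice and a truncated moment condition holds. -/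
def AssumptionA2 (ν : Measure (ℕ → ℝ)) : Prop :=
  (∀ r : ℝ, 0 < r → ν {q | ∃ m : ℤ, envX q = r * m} < 1) ∧
  ∃ ε : ℝ, 0 < ε ∧ ∃ a : ℕ, ∀ x : ℝ, 0 < x →
    IntegrableOn (fun q => Real.log (max (xi q a) 1) ^ ((2 : ℝ) + ε))
      {q | -x < envX q} ν

/-- `q` has a linear fractional generating function with mean `m = pmfMean q` and
second derivative `b` at `1`. -/
def IsLF (q : ℕ → ℝ) : Prop :=
  0 < pmfMean q ∧ ∃ b : ℝ, 0 ≤ b ∧ ∀ s ∈ Set.Icc (0 : ℝ) 1,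
    pgf q s = 1 - (1 - s) / ((pmfMean q)⁻¹ + b * ((pmfMean q) ^ 2)⁻¹ * (1 - s) / 2)

open scoped ENNReal

def convE (q r : ℕ → ℝ≥0∞) (k : ℕ) : ℝ≥0∞ := ∑ j ∈ Finset.range (k + 1), q j * r (k - j)

def cpE (q : ℕ → ℝ≥0∞) : ℕ → ℕ → ℝ≥0∞
  | 0 => fun k => if k = 0 then 1 else 0
  | z + 1 => convE q (cpE q z)

def qE (e : ℕ → ℕ → ℝ≥0∞) : ℕ → ℕ → ℕ → ℝ≥0∞
  | 0, k, j => if j = k then 1 else 0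
  | n + 1, k, j => ∑' i : ℕ, qE e n k i * cpE (e n) i j

def pE (q : ℕ → ℝ≥0∞) (s : ℝ≥0∞) : ℝ≥0∞ := ∑' k, q k * s ^ k

def dE (q : ℕ → ℝ≥0∞) (s : ℝ≥0∞) : ℝ≥0∞ := ∑' k : ℕ, (k : ℝ≥0∞) * q k * s ^ (k - 1)

def FE (e : ℕ → ℕ → ℝ≥0∞) (i n : ℕ) (s : ℝ≥0∞) : ℝ≥0∞ :=
  (List.range (n - i)).foldr (fun m t => pE (e (i + m)) t) s

theorem conv_tsum (q r φ : ℕ → ℝ≥0∞) :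
    ∑' j, convE q r j * φ j = ∑' a, ∑' b, q a * r b * φ (a + b) := by
  rw [← ENNReal.tsum_prod (f := fun a b => q a * r b * φ (a + b)),
    ← (Finset.HasAntidiagonal.sigmaAntidiagonalEquivProd (A := ℕ)).tsum_eq, ENNReal.tsum_sigma']
  refine tsum_congr fun j => ?_
  rw [tsum_fintype, convE, Finset.sum_mul,
    ← Finset.Nat.sum_antidiagonal_eq_sum_range_succ (fun a b => q a * r b * φ j) j]
  rw [← Finset.sum_coe_sort]
  refine Finset.sum_congr rfl fun x _ => ?_
  have := Finset.HasAntidiagonal.mem_antidiagonal.1 x.2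
  simp [Finset.HasAntidiagonal.sigmaAntidiagonalEquivProd, this]

theorem pE_cp (q : ℕ → ℝ≥0∞) (s : ℝ≥0∞) (i : ℕ) :
    ∑' j, cpE q i j * s ^ j = pE q s ^ i := by
  induction i with
  | zero =>
    rw [tsum_eq_single 0]
    · simp [cpE]
    · intro j hj; simp [cpE, hj]
  | succ i ih =>
    simp only [cpE]
    rw [conv_tsum, pow_succ', ← ih, pE, ← ENNReal.tsum_mul_right]
    refine tsum_congr fun a => ?_
    rw [← ENNReal.tsum_mul_left]
    refine tsum_congr fun b => ?_
    ring

theorem dE_cp (q : ℕ → ℝ≥0∞) (s : ℝ≥0∞) (i : ℕ) :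
    ∑' j, cpE q i j * ((j : ℝ≥0∞) * s ^ (j - 1)) = i * pE q s ^ (i - 1) * dE q s := by
  induction i with
  | zero =>
    rw [tsum_eq_single 0]
    · simp
    · intro j hj; simp [cpE, hj]
  | succ i ih =>
    simp only [cpE]
    rw [conv_tsum]
    have h1 : ∀ a b : ℕ, q a * cpE q i b * (((a + b : ℕ) : ℝ≥0∞) * s ^ (a + b - 1))
        = ((a : ℝ≥0∞) * q a * s ^ (a - 1)) * (cpE q i b * s ^ b)
          + (q a * s ^ a) * (cpE q i b * ((b : ℝ≥0∞) * s ^ (b - 1))) := by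
      intro a b
      rcases a with _ | a
      · simp; ring
      · rcases b with _ | b
        · simp; ring
        · have : a + 1 + (b + 1) - 1 = a + b + 1 := by omega
          rw [this]
          simp only [Nat.add_sub_cancel]
          push_cast
          ring
    simp_rw [h1, ENNReal.tsum_add, ENNReal.tsum_mul_left, ENNReal.tsum_mul_right]
    rw [pE_cp, ih]
    change dE q s * _ + pE q s * _ = _
    rcases i with _ | i
    · simp
    · simp only [Nat.add_sub_cancel]
      push_cast
      ring

theorem FE_self (e : ℕ → ℕ → ℝ≥0∞) (n : ℕ) (s : ℝ≥0∞) : FE e n n s = s := by simp [FE]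

theorem FE_succ (e : ℕ → ℕ → ℝ≥0∞) (i n : ℕ) (h : i ≤ n) (s : ℝ≥0∞) :
    FE e i (n + 1) s = FE e i n (pE (e n) s) := by
  have : n + 1 - i = (n - i) + 1 := by omega
  rw [FE, this, List.range_succ, List.foldr_append]
  simp [FE, show i + (n - i) = n by omega]

theorem dE_q (e : ℕ → ℕ → ℝ≥0∞) (n z : ℕ) (s : ℝ≥0∞) :
    ∑' k, qE e n z k * ((k : ℝ≥0∞) * s ^ (k - 1)) =
      z * FE e 0 n s ^ (z - 1) * ∏ i ∈ Finset.Icc 1 n, dE (e (i - 1)) (FE e i n s) := by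
  induction n generalizing s with
  | zero =>
    rw [tsum_eq_single z]
    · simp [qE, FE]
    · intro j hj; simp [qE, hj]
  | succ n ih =>
    simp only [qE]
    simp_rw [← ENNReal.tsum_mul_right]
    rw [ENNReal.tsum_comm]
    simp_rw [mul_assoc, ENNReal.tsum_mul_left]
    simp_rw [dE_cp, ← mul_assoc, ENNReal.tsum_mul_right]
    simp_rw [mul_assoc]
    rw [ih, Finset.prod_Icc_succ_top (by omega), FE_self, FE_succ _ _ _ (by omega)]
    have hP : ∏ i ∈ Finset.Icc 1 n, dE (e (i - 1)) (FE e i (n + 1) s) =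
        ∏ i ∈ Finset.Icc 1 n, dE (e (i - 1)) (FE e i n (pE (e n) s)) :=
      Finset.prod_congr rfl fun i hi => by rw [FE_succ e i n (Finset.mem_Icc.1 hi).2 s]
    rw [hP]
    simp [mul_assoc]

theorem cp_zero (q : ℕ → ℝ≥0∞) (i : ℕ) : cpE q i 0 = q 0 ^ i := by
  induction i with
  | zero => simp [cpE]
  | succ i ih => simp [cpE, convE, ih, pow_succ']

theorem cp_lower (q : ℕ → ℝ≥0∞) (i j : ℕ) (hj : 1 ≤ j) :
    (i : ℝ≥0∞) * q 0 ^ (i - 1) * q j ≤ cpE q i j := by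
  induction i with
  | zero => simp
  | succ i ih =>
    simp only [cpE, convE]
    have hsub : ({0, j} : Finset ℕ) ⊆ Finset.range (j + 1) := by
      intro x; simp; omega
    refine le_trans ?_ (Finset.sum_le_sum_of_subset hsub)
    rw [Finset.sum_pair (by omega)]
    simp only [Nat.sub_self, Nat.sub_zero, cp_zero]
    refine le_trans (le_of_eq ?_) (add_le_add_left (mul_le_mul_right ih (q 0)) _)
    rcases i with _ | i
    · simp
    · simp only [Nat.add_sub_cancel]
      push_cast
      ring

theorem qE_congr (e e' : ℕ → ℕ → ℝ≥0∞) (n k j : ℕ) (h : ∀ i < n, e i = e' i) :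
    qE e n k j = qE e' n k j := by
  induction n generalizing j with
  | zero => rfl
  | succ n ih =>
    simp only [qE]
    refine tsum_congr fun i => ?_
    rw [ih i (fun i hi => h i (by omega)), h n (by omega)]

theorem qE_tsum (e : ℕ → ℕ → ℝ≥0∞) (h : ∀ i, ∑' k, e i k = 1) (n k : ℕ) :
    ∑' j, qE e n k j = 1 := by
  induction n with
  | zero =>
    rw [tsum_eq_single k]
    · simp [qE]
    · intro j hj; simp [qE, hj]
  | succ n ih =>
    simp only [qE]
    rw [ENNReal.tsum_comm]
    simp_rw [ENNReal.tsum_mul_left]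
    have : ∀ i, ∑' j, cpE (e n) i j = 1 := by
      intro i
      have := pE_cp (e n) 1 i
      simpa [pE, h n] using this
    simp [this, ih]

theorem qE_le (e : ℕ → ℕ → ℝ≥0∞) (h : ∀ i, ∑' k, e i k = 1) (n k j : ℕ) :
    qE e n k j ≤ 1 := (ENNReal.le_tsum j).trans (qE_tsum e h n k).le

/-! real / extended correspondence -/

def toE (q : ℕ → ℝ) : ℕ → ℝ≥0∞ := fun k => ENNReal.ofReal (q k)

theorem cp_fin (q : ℕ → ℝ≥0∞) (hq : ∀ k, q k ≠ ∞) (i j : ℕ) : cpE q i j ≠ ∞ := by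
  induction i generalizing j with
  | zero => simp only [cpE]; split_ifs <;> simp
  | succ i ih =>
    simp only [cpE, convE]
    exact ENNReal.sum_ne_top.2 fun a _ => ENNReal.mul_ne_top (hq _) (ih _)

theorem cp_real (q : ℕ → ℝ) (hq : ∀ k, 0 ≤ q k) (i j : ℕ) :
    convPow q i j = (cpE (toE q) i j).toReal := by
  induction i generalizing j with
  | zero => simp only [cpE, convPow]; split_ifs <;> simp
  | succ i ih =>
    simp only [cpE, convE, convPow, conv]
    have hf : ∀ k, toE q k ≠ ∞ := fun k => ENNReal.ofReal_ne_top
    rw [ENNReal.toReal_sum (fun a _ => ENNReal.mul_ne_top (hf _) (cp_fin _ hf _ _))]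
    refine Finset.sum_congr rfl fun a _ => ?_
    rw [ENNReal.toReal_mul, ih, toE, ENNReal.toReal_ofReal (hq _)]

theorem toE_sum (q : ℕ → ℝ) (h : IsPMF q) : ∑' k, toE q k = 1 := by
  have hs : Summable q := by
    by_contra hn
    have := h.2
    rw [tsum_eq_zero_of_not_summable hn] at this
    norm_num at this
  unfold toE
  rw [← ENNReal.ofReal_tsum_of_nonneg h.1 hs, h.2, ENNReal.ofReal_one]

theorem q_real (e : ℕ → ℕ → ℝ) (he : ∀ i, IsPMF (e i)) (n k j : ℕ) :
    qtrans e n k j = (qE (fun i => toE (e i)) n k j).toReal := by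
  induction n generalizing j with
  | zero => simp only [qtrans, qE]; split_ifs <;> simp
  | succ n ih =>
    simp only [qtrans, qE]
    have hf : ∀ k, toE (e n) k ≠ ∞ := fun k => ENNReal.ofReal_ne_top
    rw [ENNReal.tsum_toReal_eq]
    · refine tsum_congr fun i => ?_
      rw [ENNReal.toReal_mul, ih, cp_real _ (he n).1]
    · intro i
      exact ENNReal.mul_ne_top ((qE_le _ (fun i => toE_sum _ (he i)) _ _ _).trans_lt
        ENNReal.one_lt_top).ne (cp_fin _ hf _ _)

theorem pE_le (q : ℕ → ℝ≥0∞) (h : ∑' k, q k = 1) (s : ℝ≥0∞) (hs : s ≤ 1) : pE q s ≤ 1 := by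
  rw [← h]
  exact ENNReal.tsum_le_tsum fun k => mul_le_of_le_one_right' (pow_le_one₀ (by simp) hs)

theorem p_real (q : ℕ → ℝ) (h : IsPMF q) (s : ℝ≥0∞) (hs : s ≤ 1) :
    pgf q s.toReal = (pE (toE q) s).toReal := by
  have hs' : s ≠ ∞ := (hs.trans_lt ENNReal.one_lt_top).ne
  rw [pE, ENNReal.tsum_toReal_eq]
  · simp [pgf, toE, ENNReal.toReal_ofReal (h.1 _)]
  · intro k
    exact ENNReal.mul_ne_top ENNReal.ofReal_ne_top (ENNReal.pow_ne_top hs')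

theorem d_real (q : ℕ → ℝ) (h : IsPMF q) (s : ℝ≥0∞) (hs : s ≤ 1) :
    dpgf q s.toReal = (dE (toE q) s).toReal := by
  have hs' : s ≠ ∞ := (hs.trans_lt ENNReal.one_lt_top).ne
  rw [dE, ENNReal.tsum_toReal_eq]
  · simp [dpgf, toE, ENNReal.toReal_ofReal (h.1 _)]
  · intro k
    exact ENNReal.mul_ne_top (ENNReal.mul_ne_top (by simp) ENNReal.ofReal_ne_top)
      (ENNReal.pow_ne_top hs')

theorem F_real (e : ℕ → ℕ → ℝ) (he : ∀ i, IsPMF (e i)) (i n : ℕ) :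
    FE (fun i => toE (e i)) i n 0 ≤ 1 ∧
    Fcomp e i n 0 = (FE (fun i => toE (e i)) i n 0).toReal := by
  unfold FE Fcomp
  induction List.range (n - i) with
  | nil => simp
  | cons a l ih =>
    simp only [List.foldr_cons]
    refine ⟨pE_le _ (toE_sum _ (he _)) _ ih.1, ?_⟩
    rw [ih.2, p_real _ (he _) _ ih.1]

def GE (e : ℕ → ℕ → ℝ≥0∞) (z n : ℕ) : ℝ≥0∞ :=
  e n z * FE e 0 (n + 1) 0 ^ (z - 1) *
    ∏ i ∈ Finset.Icc 1 n, dE (e (i - 1)) (FE e i (n + 1) 0)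

theorem G_real (e : ℕ → ℕ → ℝ) (he : ∀ i, IsPMF (e i)) (z n : ℕ) :
    e n z * Fcomp e 0 (n + 1) 0 ^ (z - 1) *
      ∏ i ∈ Finset.Icc 1 n, dpgf (e (i - 1)) (Fcomp e i (n + 1) 0)
    = (GE (fun i => toE (e i)) z n).toReal := by
  unfold GE
  rw [ENNReal.toReal_mul, ENNReal.toReal_mul, ENNReal.toReal_pow, ENNReal.toReal_prod,
    (F_real e he _ _).2,
    show (toE (e n) z).toReal = e n z from ENNReal.toReal_ofReal ((he n).1 z)]
  congr 1
  refine Finset.prod_congr rfl fun i _ => ?_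
  rw [(F_real e he i _).2, d_real _ (he _) _ (F_real e he i _).1]

theorem GE_eq (e : ℕ → ℕ → ℝ≥0∞) (z n : ℕ) :
    z * GE e z n = ∑' k, qE e n z k * (k * e n 0 ^ (k - 1) * e n z) := by
  have hp : pE (e n) 0 = e n 0 := by
    rw [pE, tsum_eq_single 0]
    · simp
    · intro k hk; simp [hk]
  have := dE_q e n z (pE (e n) 0)
  simp_rw [← mul_assoc, ENNReal.tsum_mul_right]
  simp_rw [← mul_assoc] at this
  rw [hp] at this
  rw [this, GE, FE_succ _ _ _ (by omega),
    Finset.prod_congr rfl (fun i hi => by rw [FE_succ e i n (Finset.mem_Icc.1 hi).2 0]), hp]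
  ring

theorem GE_upper (e : ℕ → ℕ → ℝ≥0∞) (z n : ℕ) (hz : 1 ≤ z) :
    z * GE e z n ≤ qE e (n + 1) z z := by
  rw [GE_eq, qE]
  exact ENNReal.tsum_le_tsum fun k => mul_le_mul_right (cp_lower _ _ _ hz) _

theorem GE_lower (e : ℕ → ℕ → ℝ≥0∞) (z n : ℕ) :
    qE e n z z * (z * e n 0 ^ (z - 1) * e n z) ≤ z * GE e z n := by
  rw [GE_eq]
  exact ENNReal.le_tsum (f := fun k => qE e n z k * (k * e n 0 ^ (k - 1) * e n z)) z


/-! annealed quantities -/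

theorem cp_meas {Ω : Type*} [MeasurableSpace Ω] (E : Ω → ℕ → ℝ≥0∞)
    (h : ∀ k, Measurable fun ω => E ω k) (i j : ℕ) : Measurable fun ω => cpE (E ω) i j := by
  induction i generalizing j with
  | zero => simp only [cpE]; exact measurable_const
  | succ i ih =>
    simp only [cpE, convE]
    exact Finset.measurable_sum _ fun a _ => (h a).mul (ih _)

theorem q_meas {Ω : Type*} [MeasurableSpace Ω] (E : Ω → ℕ → ℕ → ℝ≥0∞)
    (h : ∀ i k, Measurable fun ω => E ω i k) (n k j : ℕ) :
    Measurable fun ω => qE (E ω) n k j := by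
  induction n generalizing j with
  | zero => simp only [qE]; exact measurable_const
  | succ n ih =>
    simp only [qE]
    exact Measurable.tsum fun i => (ih i).mul (cp_meas _ (h n) _ _)

theorem p_meas {Ω : Type*} [MeasurableSpace Ω] (E : Ω → ℕ → ℝ≥0∞)
    (h : ∀ k, Measurable fun ω => E ω k) (s : Ω → ℝ≥0∞) (hs : Measurable s) :
    Measurable fun ω => pE (E ω) (s ω) :=
  Measurable.tsum fun i => (h i).mul (hs.pow_const _)

theorem d_meas {Ω : Type*} [MeasurableSpace Ω] (E : Ω → ℕ → ℝ≥0∞)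
    (h : ∀ k, Measurable fun ω => E ω k) (s : Ω → ℝ≥0∞) (hs : Measurable s) :
    Measurable fun ω => dE (E ω) (s ω) :=
  Measurable.tsum fun i => (measurable_const.mul (h i)).mul (hs.pow_const _)

theorem F_meas {Ω : Type*} [MeasurableSpace Ω] (E : Ω → ℕ → ℕ → ℝ≥0∞)
    (h : ∀ i k, Measurable fun ω => E ω i k) (i n : ℕ) :
    Measurable fun ω => FE (E ω) i n 0 := by
  unfold FE
  induction List.range (n - i) with
  | nil => exact measurable_const
  | cons a l ih => exact p_meas _ (h _) _ ih

theorem G_meas {Ω : Type*} [MeasurableSpace Ω] (E : Ω → ℕ → ℕ → ℝ≥0∞)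
    (h : ∀ i k, Measurable fun ω => E ω i k) (z n : ℕ) :
    Measurable fun ω => GE (E ω) z n :=
  ((h _ _).mul ((F_meas E h _ _).pow_const _)).mul
    (Finset.measurable_prod _ fun i _ => d_meas _ (h _) _ (F_meas E h _ _))

def xE (n : ℕ) (e : Fin n → ℕ → ℝ) : ℕ → ℕ → ℝ≥0∞ := fun i => toE (extEnv n e i)

theorem x_meas (n i k : ℕ) : Measurable fun e : Fin n → ℕ → ℝ => xE n e i k := by
  unfold xE toE extEnv
  by_cases h : i < n
  · simp only [h, dite_true]
    exact ENNReal.measurable_ofReal.comp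
      ((measurable_pi_apply k).comp (measurable_pi_apply _))
  · simp only [h, dite_false]
    exact measurable_const

def aE (ν : Measure (ℕ → ℝ)) [SigmaFinite ν] (n k j : ℕ) : ℝ≥0∞ :=
  ∫⁻ e, qE (xE n e) n k j ∂(envPi ν n)

def kE (ν : Measure (ℕ → ℝ)) (i j : ℕ) : ℝ≥0∞ := ∫⁻ q, cpE (toE q) i j ∂ν

theorem toE_meas (k : ℕ) : Measurable fun q : ℕ → ℝ => toE q k :=
  ENNReal.measurable_ofReal.comp (measurable_pi_apply k)

theorem split (ν : Measure (ℕ → ℝ)) [IsProbabilityMeasure ν] (n k i : ℕ)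
    (φ : (ℕ → ℝ) → ℝ≥0∞) (hφ : Measurable φ) :
    ∫⁻ e, qE (xE (n + 1) e) n k i * φ (e (Fin.last n)) ∂(envPi ν (n + 1))
      = aE ν n k i * ∫⁻ q, φ q ∂ν := by
  have hp := measurePreserving_piFinSuccAbove (fun _ : Fin (n + 1) => ν) (Fin.last n)
  have h1 := hp.lintegral_comp_emb (MeasurableEquiv.measurableEmbedding _)
    (fun p : (ℕ → ℝ) × (Fin n → ℕ → ℝ) => φ p.1 * qE (xE n p.2) n k i)
  rw [lintegral_prod_mul hφ.aemeasurable (q_meas _ (x_meas n) n k i).aemeasurable] at h1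
  rw [mul_comm, aE, envPi, envPi, ← h1]
  refine lintegral_congr fun e => ?_
  rw [mul_comm]
  congr 1
  apply qE_congr
  intro m hm
  simp only [xE, extEnv, hm, dite_true, Nat.lt_succ_of_lt hm]
  congr 1
  simp [MeasurableEquiv.piFinSuccAbove, Fin.insertNthEquiv, Fin.init]

theorem x_last (n : ℕ) (e : Fin (n + 1) → ℕ → ℝ) : xE (n + 1) e n = toE (e (Fin.last n)) := by
  simp [xE, extEnv, Fin.last]

theorem aE_succ (ν : Measure (ℕ → ℝ)) [IsProbabilityMeasure ν] (n k j : ℕ) :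
    aE ν (n + 1) k j = ∑' i, aE ν n k i * kE ν i j := by
  rw [aE]
  simp only [qE, x_last]
  rw [lintegral_tsum]
  · refine tsum_congr fun i => ?_
    exact split ν n k i (fun q => cpE (toE q) i j) (cp_meas _ toE_meas _ _)
  · intro i
    exact ((q_meas _ (x_meas _) _ _ _).mul
      (cp_meas _ (fun k => (toE_meas k).comp (measurable_pi_apply _)) _ _)).aemeasurable

theorem aE_zero (ν : Measure (ℕ → ℝ)) [IsProbabilityMeasure ν] (k j : ℕ) :
    aE ν 0 k j = if j = k then 1 else 0 := by
  simp [aE, qE, envPi]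

theorem aE_one (ν : Measure (ℕ → ℝ)) [IsProbabilityMeasure ν] (k j : ℕ) :
    aE ν 1 k j = kE ν k j := by
  rw [aE_succ, tsum_eq_single k]
  · simp [aE_zero]
  · intro i hi; simp [aE_zero, hi]

theorem aE_add (ν : Measure (ℕ → ℝ)) [IsProbabilityMeasure ν] (m n k j : ℕ) :
    aE ν (m + n) k j = ∑' i, aE ν m k i * aE ν n i j := by
  induction n generalizing j with
  | zero =>
    rw [tsum_eq_single j]
    · simp [aE_zero]
    · intro i hi; simp [aE_zero, hi.symm]
  | succ n ih =>
    rw [← add_assoc, aE_succ]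
    simp_rw [ih, aE_succ, ← ENNReal.tsum_mul_left, ← ENNReal.tsum_mul_right]
    rw [ENNReal.tsum_comm]
    simp [mul_assoc]

theorem aE_mul (ν : Measure (ℕ → ℝ)) [IsProbabilityMeasure ν] (m n k i j : ℕ) :
    aE ν m k i * aE ν n i j ≤ aE ν (m + n) k j := by
  rw [aE_add]
  exact ENNReal.le_tsum (f := fun i => aE ν m k i * aE ν n i j) i

theorem ae_env (ν : Measure (ℕ → ℝ)) [IsProbabilityMeasure ν] (hpmf : ∀ᵐ q ∂ν, IsPMF q) (n : ℕ) :
    ∀ᵐ e ∂(envPi ν n), ∀ i, IsPMF (extEnv n e i) := by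
  have h : ∀ᵐ e ∂(envPi ν n), ∀ i : Fin n, IsPMF (e i) := by
    rw [ae_all_iff]
    intro i
    exact (measurePreserving_eval (fun _ : Fin n => ν) i).quasiMeasurePreserving.ae hpmf
  filter_upwards [h] with e he i
  unfold extEnv
  split_ifs with hi
  · exact he _
  · refine ⟨fun k => by positivity, by simp⟩

theorem aE_le (ν : Measure (ℕ → ℝ)) [IsProbabilityMeasure ν] (hpmf : ∀ᵐ q ∂ν, IsPMF q)
    (n k j : ℕ) : aE ν n k j ≤ 1 := by
  have : IsProbabilityMeasure (envPi ν n) := by unfold envPi; infer_instance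
  refine (lintegral_mono_ae (g := fun _ => 1) ?_).trans (by simp)
  filter_upwards [ae_env ν hpmf n] with e he
  exact qE_le _ (fun i => toE_sum _ (he i)) _ _ _

theorem aP_eq (ν : Measure (ℕ → ℝ)) [IsProbabilityMeasure ν] (hpmf : ∀ᵐ q ∂ν, IsPMF q)
    (n k j : ℕ) : aP ν n k j = (aE ν n k j).toReal := by
  rw [aP, aE, ← integral_toReal (q_meas _ (x_meas n) n k j).aemeasurable]
  · refine integral_congr_ae ?_
    filter_upwards [ae_env ν hpmf n] with e he
    exact q_real _ he _ _ _
  · filter_upwards [ae_env ν hpmf n] with e he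
    exact (qE_le _ (fun i => toE_sum _ (he i)) _ _ _).trans_lt ENNReal.one_lt_top

def gE (ν : Measure (ℕ → ℝ)) [SigmaFinite ν] (z n : ℕ) : ℝ≥0∞ :=
  ∫⁻ e, GE (xE (n + 1) e) z n ∂(envPi ν (n + 1))

theorem g_eq (ν : Measure (ℕ → ℝ)) [IsProbabilityMeasure ν] (hpmf : ∀ᵐ q ∂ν, IsPMF q)
    (z n : ℕ) (hz : 1 ≤ z) : geigerExp ν z (n + 1) = (gE ν z n).toReal := by
  rw [geigerExp, gE, ← integral_toReal (G_meas _ (x_meas (n + 1)) z n).aemeasurable]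
  · refine integral_congr_ae ?_
    filter_upwards [ae_env ν hpmf (n + 1)] with e he
    exact G_real _ he _ _
  · filter_upwards [ae_env ν hpmf (n + 1)] with e he
    have h1 := (GE_upper (xE (n + 1) e) z n hz).trans (qE_le _ (fun i => toE_sum _ (he i)) _ _ _)
    have h2 : (1 : ℝ≥0∞) * GE (xE (n + 1) e) z n ≤ z * GE (xE (n + 1) e) z n :=
      mul_le_mul_left (by exact_mod_cast hz) _
    rw [one_mul] at h2
    exact (h2.trans h1).trans_lt ENNReal.one_lt_top

theorem g_upper (ν : Measure (ℕ → ℝ)) [IsProbabilityMeasure ν] (z n : ℕ) (hz : 1 ≤ z) :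
    gE ν z n ≤ aE ν (n + 1) z z := by
  refine lintegral_mono fun e => ?_
  refine le_trans ?_ (GE_upper _ z n hz)
  have h2 : (1 : ℝ≥0∞) * GE (xE (n + 1) e) z n ≤ z * GE (xE (n + 1) e) z n :=
      mul_le_mul_left (by exact_mod_cast hz) _
  rwa [one_mul] at h2

def cE (ν : Measure (ℕ → ℝ)) (i j : ℕ) : ℝ≥0∞ :=
  ∫⁻ q, (i * toE q 0 ^ (i - 1) * toE q j) ∂ν

theorem cM (i j : ℕ) : Measurable fun q : ℕ → ℝ => (i * toE q 0 ^ (i - 1) * toE q j : ℝ≥0∞) :=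
  (measurable_const.mul ((toE_meas 0).pow_const _)).mul (toE_meas j)

theorem g_lower (ν : Measure (ℕ → ℝ)) [IsProbabilityMeasure ν] (z n : ℕ) :
    aE ν n z z * cE ν z z ≤ z * gE ν z n := by
  rw [cE, ← split ν n z z _ (cM z z), gE,
    ← lintegral_const_mul _ (G_meas _ (x_meas (n + 1)) z n)]
  refine lintegral_mono fun e => ?_
  have := GE_lower (xE (n + 1) e) z n
  rwa [x_last] at this

theorem c_pos (ν : Measure (ℕ → ℝ)) [IsProbabilityMeasure ν] (i j : ℕ) (hi : 1 ≤ i)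
    (hj : j ∈ Iset ν) : 0 < cE ν i j := by
  rw [cE, lintegral_pos_iff_support (cM i j)]
  refine hj.2.trans_le (measure_mono ?_)
  intro q hq
  have h0 : toE q 0 ≠ 0 := by simpa [toE] using hq.2
  have h1 : toE q j ≠ 0 := by simpa [toE] using hq.1
  simp only [Function.mem_support]
  exact mul_ne_zero (mul_ne_zero (by exact_mod_cast (by omega : i ≠ 0)) (pow_ne_zero _ h0)) h1

theorem a1_pos (ν : Measure (ℕ → ℝ)) [IsProbabilityMeasure ν] (i j : ℕ) (hi : 1 ≤ i)
    (hj : j ∈ Iset ν) : 0 < aE ν 1 i j := by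
  rw [aE_one]
  exact (c_pos ν i j hi hj).trans_le (lintegral_mono fun q => cp_lower _ _ _ hj.1)

theorem fekete (a : ℕ → ℝ) (h0 : ∀ n, 0 < a n) (h1 : ∀ n, a n ≤ 1)
    (hm : ∀ m n, a m * a n ≤ a (m + n)) :
    ∃ L : ℝ, Tendsto (fun n : ℕ => (1 / (n : ℝ)) * Real.log (a n)) atTop (𝓝 L) := by
  have hs : Subadditive fun n => -Real.log (a n) := by
    intro m n
    have := Real.log_le_log (mul_pos (h0 m) (h0 n)) (hm m n)
    rw [Real.log_mul (h0 m).ne' (h0 n).ne'] at this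
    linarith
  refine ⟨-hs.lim, ?_⟩
  have := (hs.tendsto_lim ⟨0, ?_⟩).neg
  · refine this.congr fun n => ?_
    ring
  · rintro _ ⟨n, rfl⟩
    have := Real.log_nonpos (h0 n).le (h1 n)
    exact div_nonneg (by linarith) (by positivity)

theorem shiftlim (u : ℕ → ℝ) (L c : ℝ) (k : ℕ)
    (h : Tendsto (fun n : ℕ => (1 / (n : ℝ)) * u n) atTop (𝓝 L)) :
    Tendsto (fun n : ℕ => (1 / (n : ℝ)) * (u (n + k) + c)) atTop (𝓝 L) := by
  have h1 := (tendsto_add_atTop_iff_nat k).2 h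
  have h2 : Tendsto (fun n : ℕ => 1 + (k : ℝ) * (1 / (n : ℝ))) atTop (𝓝 (1 + k * 0)) :=
    (tendsto_one_div_atTop_nhds_zero_nat.const_mul _).const_add _
  have h3 := (h1.mul h2).add (tendsto_one_div_atTop_nhds_zero_nat (𝕜 := ℝ) |>.mul_const c)
  simp only [mul_zero, add_zero, mul_one, zero_mul] at h3
  refine h3.congr' ?_
  filter_upwards [eventually_gt_atTop 0] with n hn
  have : (n : ℝ) ≠ 0 := by positivity
  have : ((n : ℝ) + k) ≠ 0 := by positivity
  push_cast
  field_simp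

theorem squeeze (a b : ℕ → ℝ) (L c1 c2 : ℝ) (k1 k2 : ℕ) (h0 : ∀ n, 0 < a n)
    (hc1 : 0 < c1) (hc2 : 0 < c2)
    (h1 : ∀ n, c1 * a n ≤ b (n + k1)) (h2 : ∀ n, c2 * b (n + k1) ≤ a (n + k1 + k2))
    (h : Tendsto (fun n : ℕ => (1 / (n : ℝ)) * Real.log (a n)) atTop (𝓝 L)) :
    Tendsto (fun n : ℕ => (1 / (n : ℝ)) * Real.log (b n)) atTop (𝓝 L) := by
  have hb : ∀ n, 0 < b (n + k1) := fun n => (mul_pos hc1 (h0 n)).trans_le (h1 n)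
  have key : Tendsto (fun n : ℕ => (1 / (n : ℝ)) * Real.log (b (n + k1))) atTop (𝓝 L) := by
    refine tendsto_of_tendsto_of_tendsto_of_le_of_le (shiftlim _ L (Real.log c1) 0 h)
      (shiftlim _ L (-Real.log c2) (k1 + k2) h) ?_ ?_
    · intro n
      refine mul_le_mul_of_nonneg_left ?_ (by positivity)
      have := Real.log_le_log (mul_pos hc1 (h0 n)) (h1 n)
      rw [Real.log_mul hc1.ne' (h0 n).ne'] at this
      simp only [add_zero]
      linarith
    · intro n
      refine mul_le_mul_of_nonneg_left ?_ (by positivity)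
      have := Real.log_le_log (mul_pos hc2 (hb n)) (h2 n)
      rw [Real.log_mul hc2.ne' (hb n).ne'] at this
      rw [← add_assoc]
      linarith
  rw [← tendsto_add_atTop_iff_nat k1]
  have h2 : Tendsto (fun n : ℕ => 1 - (k1 : ℝ) * (1 / ((n + k1 : ℕ) : ℝ))) atTop
      (𝓝 (1 - k1 * 0)) :=
    (((tendsto_add_atTop_iff_nat k1).2
      tendsto_one_div_atTop_nhds_zero_nat).const_mul _).const_sub _
  have h3 := key.mul h2
  simp only [mul_zero, sub_zero, mul_one] at h3
  refine h3.congr' ?_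
  filter_upwards [eventually_gt_atTop 0] with n hn
  have : (n : ℝ) ≠ 0 := by positivity
  have : ((n : ℝ) + k1) ≠ 0 := by positivity
  push_cast
  field_simp
  ring

theorem toReal_mul_le {x y w : ℝ≥0∞} (h : x * y ≤ w) (hw : w ≤ 1) :
    x.toReal * y.toReal ≤ w.toReal := by
  rw [← ENNReal.toReal_mul]
  exact ENNReal.toReal_mono (hw.trans_lt ENNReal.one_lt_top).ne h

/-- Lemma 5.2. If `P₁(Z₁ = 0) > 0` and `𝓘 ≠ ∅` with smallest element
`z₀`, then for all `i, j ∈ Cl(𝓘)`, `lim (1/n) log P_i(Z_n = j)` exists and equals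
`lim (1/n) log E[Q_n(z₀) f_{0,n}(0)^{z₀-1} ∏_{i=1}^{n-1} f_i'(f_{i,n}(0))]`. -/
theorem stmt3 (ν : Measure (ℕ → ℝ)) [IsProbabilityMeasure ν]
    (hpmf : ∀ᵐ q ∂ν, IsPMF q)
    (hext : 0 < aP ν 1 1 0)
    (z₀ : ℕ) (hz₀ : z₀ ∈ Iset ν ∧ ∀ j ∈ Iset ν, z₀ ≤ j) :
    ∃ L : ℝ,
      (∀ i ∈ clI ν, ∀ j ∈ clI ν,
        Tendsto (fun n : ℕ => (1 / (n : ℝ)) * Real.log (aP ν n i j)) atTop (𝓝 L)) ∧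
      Tendsto (fun n : ℕ => (1 / (n : ℝ)) * Real.log (geigerExp ν z₀ n)) atTop (𝓝 L) := by
  obtain ⟨hzI, -⟩ := hz₀
  have hz1 : 1 ≤ z₀ := hzI.1
  have hle := aE_le ν hpmf
  have hpos : ∀ n i j, 0 < aE ν n i j → 0 < (aE ν n i j).toReal := fun n i j h =>
    ENNReal.toReal_pos h.ne' ((hle n i j).trans_lt ENNReal.one_lt_top).ne
  have hA : ∀ n, 0 < aE ν n z₀ z₀ := by
    intro n
    induction n with
    | zero => simp [aE_zero]
    | succ n ih =>
      exact (ENNReal.mul_pos ih.ne' (a1_pos ν z₀ z₀ hz1 hzI).ne').trans_le (aE_mul ν n 1 _ _ _)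
  have ha0 : ∀ n, 0 < (aE ν n z₀ z₀).toReal := fun n => hpos _ _ _ (hA n)
  have hmono : ∀ {x y : ℝ≥0∞}, x ≤ y → y ≤ 1 → x.toReal ≤ y.toReal := fun h hy =>
    ENNReal.toReal_mono (hy.trans_lt ENNReal.one_lt_top).ne h
  obtain ⟨L, hL⟩ := fekete (fun n => (aE ν n z₀ z₀).toReal) ha0
    (fun n => by simpa using hmono (hle n z₀ z₀) le_rfl)
    (fun m n => toReal_mul_le (aE_mul ν m n _ _ _) (hle _ _ _))
  have hreach : ∀ j ∈ clI ν, ∃ m, 0 < aE ν m z₀ j := by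
    rintro j ⟨_, n, i, hi, hp⟩
    rw [aP_eq ν hpmf] at hp
    have hp' : aE ν n i j ≠ 0 := fun h => by simp [h] at hp
    exact ⟨1 + n, (ENNReal.mul_pos (a1_pos ν z₀ i hz1 hi).ne' hp').trans_le (aE_mul ν 1 n _ _ _)⟩
  refine ⟨L, ?_, ?_⟩
  · intro i hi j hj
    obtain ⟨mi, hmi⟩ := hreach i hi
    obtain ⟨mj, hmj⟩ := hreach j hj
    have hi1 := a1_pos ν i z₀ hi.1 hzI
    have hj1 := a1_pos ν j z₀ hj.1 hzI
    simp_rw [aP_eq ν hpmf]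
    refine squeeze (fun n => (aE ν n z₀ z₀).toReal) _ L
      ((aE ν 1 i z₀ * aE ν mj z₀ j).toReal) ((aE ν mi z₀ i * aE ν 1 j z₀).toReal)
      (1 + mj) (mi + 1) ha0 ?_ ?_ ?_ ?_ hL
    · rw [ENNReal.toReal_mul]; exact mul_pos (hpos _ _ _ hi1) (hpos _ _ _ hmj)
    · rw [ENNReal.toReal_mul]; exact mul_pos (hpos _ _ _ hmi) (hpos _ _ _ hj1)
    · intro n
      refine toReal_mul_le ?_ (hle _ _ _)
      rw [show n + (1 + mj) = 1 + n + mj by ring]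
      refine le_trans (le_of_eq ?_) ((mul_le_mul_left (aE_mul ν 1 n i z₀ z₀) _).trans
        (aE_mul ν (1 + n) mj i z₀ j))
      ring
    · intro n
      refine toReal_mul_le ?_ (hle _ _ _)
      generalize n + (1 + mj) = N
      rw [show N + (mi + 1) = mi + N + 1 by ring]
      refine le_trans (le_of_eq ?_) ((mul_le_mul_left (aE_mul ν mi N z₀ i j) _).trans
        (aE_mul ν (mi + N) 1 z₀ j z₀))
      ring
  · have hc := c_pos ν z₀ z₀ hz1 hzI
    have hcle : cE ν z₀ z₀ ≤ 1 := by
      refine le_trans ?_ (hle 1 z₀ z₀)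
      rw [aE_one]
      exact lintegral_mono fun q => cp_lower _ _ _ hz1
    have hzpos : (0 : ℝ) < z₀ := by exact_mod_cast hz1
    have hgle : ∀ n, gE ν z₀ n ≤ 1 := fun n => (g_upper ν z₀ n hz1).trans (hle _ _ _)
    have hcr : 0 < (cE ν z₀ z₀).toReal :=
      ENNReal.toReal_pos hc.ne' (hcle.trans_lt ENNReal.one_lt_top).ne
    refine squeeze (fun n => (aE ν n z₀ z₀).toReal) _ L
      ((cE ν z₀ z₀).toReal / z₀) 1 1 0 ha0 (div_pos hcr hzpos) one_pos ?_ ?_ hL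
    · intro n
      rw [g_eq ν hpmf z₀ n hz1]
      have h := ENNReal.toReal_mono (ENNReal.mul_ne_top (by simp)
        ((hgle n).trans_lt ENNReal.one_lt_top).ne) (g_lower ν z₀ n)
      rw [ENNReal.toReal_mul, ENNReal.toReal_mul, ENNReal.toReal_natCast] at h
      rw [div_mul_eq_mul_div, div_le_iff₀ hzpos]
      linarith
    · intro n
      rw [g_eq ν hpmf z₀ n hz1, one_mul]
      exact hmono (g_upper ν z₀ n hz1) (hle _ _ _)

end
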